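/- arXiv:1105.2879 — 2 statements merged into one kernel-verified Lean document; each statement's English description precedes it below -/
import Mathlib

section
/- Let 𝒱(M̄_d) be the set of positive measures σ on [a,b] with ∫ x^m dσ = M_m for m = 0,…,d, assumed nonempty, and let h be continuous on [a,b] such that (1, x, …, x^d, h) is a Tchebycheff system. Then sup over σ ∈ 𝒱(M̄_d) of ∫ h dσ is finite and, if M̄_d is interior to the moment space, it is attained by a discrete measure supported on at most ⌈d/2⌉ + 1 points one of which is b (the upper principal representation). -/
open MeasureTheory

/-- Laplace expansion of the bordered Vandermonde determinant along its last column, in which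
any polynomial of degree at most `d` may be subtracted from the last column. -/
theorem det_vandermonde_border_eq_sum (d : ℕ) (h : ℝ → ℝ) (c : Fin (d + 1) → ℝ)
    (x : Fin (d + 2) → ℝ) :
    Matrix.det (Matrix.of fun i j : Fin (d + 2) =>
        if (j : ℕ) ≤ d then x i ^ (j : ℕ) else h (x i)) =
      ∑ i : Fin (d + 2), (-1) ^ ((i : ℕ) + (d + 1)) * (h (x i) - ∑ j, c j * x i ^ (j : ℕ)) *
        (Matrix.vandermonde fun k : Fin (d + 1) => x (i.succAbove k)).det := by
  have expand : ∀ g : ℝ → ℝ, Matrix.det (Matrix.of fun i j : Fin (d + 2) =>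
        if (j : ℕ) ≤ d then x i ^ (j : ℕ) else g (x i)) =
      ∑ i : Fin (d + 2), (-1) ^ ((i : ℕ) + (d + 1)) * g (x i) *
        (Matrix.vandermonde fun k : Fin (d + 1) => x (i.succAbove k)).det := by
    intro g
    rw [Matrix.det_succ_column _ (Fin.last (d + 1))]
    refine Finset.sum_congr rfl fun i _ => ?_
    have hm : (Matrix.of fun i j : Fin (d + 2) =>
        if (j : ℕ) ≤ d then x i ^ (j : ℕ) else g (x i)).submatrix i.succAbove
          (Fin.last (d + 1)).succAbove =
        Matrix.vandermonde fun k : Fin (d + 1) => x (i.succAbove k) := by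
      ext k j
      have : (j : ℕ) ≤ d := by omega
      simp [Matrix.vandermonde_apply, this]
    rw [hm]
    simp
  have vanish : ∀ j : Fin (d + 1), ∑ i : Fin (d + 2), (-1) ^ ((i : ℕ) + (d + 1)) *
      x i ^ (j : ℕ) * (Matrix.vandermonde fun k : Fin (d + 1) => x (i.succAbove k)).det = 0 := by
    intro j
    rw [← expand fun y => y ^ (j : ℕ)]
    refine Matrix.det_zero_of_column_eq (i := j.castSucc) (j := Fin.last (d + 1))
      (Fin.castSucc_lt_last j).ne fun k => ?_
    simp
  have hP : ∑ i : Fin (d + 2), (-1) ^ ((i : ℕ) + (d + 1)) * (∑ j, c j * x i ^ (j : ℕ)) *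
      (Matrix.vandermonde fun k : Fin (d + 1) => x (i.succAbove k)).det = 0 := by
    simp_rw [Finset.mul_sum, Finset.sum_mul]
    rw [Finset.sum_comm]
    refine Finset.sum_eq_zero fun j _ => ?_
    rw [← mul_zero (c j), ← vanish j, Finset.mul_sum]
    exact Finset.sum_congr rfl fun i _ => by ring
  rw [expand h, ← sub_zero (∑ i : Fin (d + 2), _), ← hP, ← Finset.sum_sub_distrib]
  exact Finset.sum_congr rfl fun i _ => by ring

theorem det_vandermonde_pos_of_strictMono {n : ℕ} {x : Fin n → ℝ} (hx : StrictMono x) :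
    0 < (Matrix.vandermonde x).det := by
  rw [Matrix.det_vandermonde]
  exact Finset.prod_pos fun i _ => Finset.prod_pos fun j hj =>
    sub_pos.2 (hx (Finset.mem_Ioi.1 hj))

/-- Given `n` points of `[a, b)`, there are `2 n` increasing points of `[a, b]` whose members of
even index are the given ones. -/
theorem exists_interlacing {a b : ℝ} {n : ℕ} {Z : Finset ℝ} (hcard : Z.card = n)
    (hZ : ∀ z ∈ Z, z ∈ Set.Ico a b) :
    ∃ w : ℕ → ℝ, (∀ k < 2 * n, w k ∈ Set.Icc a b) ∧ (∀ k l, k < l → l < 2 * n → w k < w l) ∧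
      ∀ k < 2 * n, Even k → w k ∈ Z := by
  set e := Z.orderEmbOfFin hcard
  obtain ⟨z, hz⟩ : ∃ z : ℕ → ℝ, ∀ k, z k = if hk : k < n then e ⟨k, hk⟩ else b :=
    ⟨_, fun _ => rfl⟩
  have hmem : ∀ k < n, z k ∈ Z := fun k hk => by
    rw [hz, dif_pos hk]; exact Z.orderEmbOfFin_mem hcard _
  have hIcc : ∀ k < n, z k ∈ Set.Ico a b := fun k hk => hZ _ (hmem k hk)
  have hn : z n = b := by simp [hz]
  have hmono : ∀ k l, k < l → l ≤ n → z k < z l := by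
    intro k l hkl hl
    rcases hl.lt_or_eq with hl | rfl
    · rw [hz, hz, dif_pos (hkl.trans hl), dif_pos hl]
      exact e.strictMono hkl
    · rw [hn]; exact (hIcc k hkl).2
  have hmono' : ∀ k l, k ≤ l → l ≤ n → z k ≤ z l := by
    intro k l hkl hl
    rcases hkl.lt_or_eq with hkl | rfl
    · exact (hmono k l hkl hl).le
    · rfl
  obtain ⟨w, hw⟩ : ∃ w : ℕ → ℝ, ∀ k, w k = if Even k then z (k / 2)
    else (z (k / 2) + z (k / 2 + 1)) / 2 := ⟨_, fun _ => rfl⟩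
  have hwl : ∀ k < 2 * n, z (k / 2) ≤ w k ∧ w k < z (k / 2 + 1) := by
    intro k hk
    have := hmono (k / 2) (k / 2 + 1) (by omega) (by omega)
    rw [hw]
    split_ifs
    · exact ⟨le_rfl, this⟩
    · constructor <;> linarith
  refine ⟨w, fun k hk => ?_, fun k l hkl hl => ?_, fun k hk hev => ?_⟩
  · have h1 := hwl k hk
    have h2 := hIcc (k / 2) (by omega)
    have h3 := hmono' (k / 2 + 1) n (by omega) le_rfl
    rw [hn] at h3
    exact ⟨h2.1.trans h1.1, h1.2.le.trans h3⟩
  · by_cases hd : k / 2 = l / 2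
    · have hk : Even k := by rw [Nat.even_iff]; omega
      have hl' : ¬ Even l := by rw [Nat.even_iff]; omega
      have := hmono (l / 2) (l / 2 + 1) (by omega) (by omega)
      rw [hw, hw, if_pos hk, if_neg hl', hd]
      linarith
    · exact (hwl k (by omega)).2.trans_le
        ((hmono' _ _ (by omega) (by omega)).trans (hwl l hl).1)
  · rw [hw, if_pos hev]
    exact hmem _ (by omega)

/-- A polynomial of degree at most `d` majorizing `h` on `[a, b]` touches it at no more than
`⌈d/2⌉` points of `[a, b)`. -/
theorem card_contact_le (a b : ℝ) (d : ℕ) (h : ℝ → ℝ)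
    (hT : ∀ x : Fin (d + 2) → ℝ, StrictMono x → (∀ i, x i ∈ Set.Icc a b) →
      0 < Matrix.det (Matrix.of fun i j : Fin (d + 2) =>
        if (j : ℕ) ≤ d then x i ^ (j : ℕ) else h (x i)))
    (c : Fin (d + 1) → ℝ) (hc : ∀ x ∈ Set.Icc a b, h x ≤ ∑ j, c j * x ^ (j : ℕ))
    (Z : Finset ℝ) (hZ : ∀ z ∈ Z, z ∈ Set.Ico a b ∧ h z = ∑ j, c j * z ^ (j : ℕ)) :
    Z.card ≤ (d + 1) / 2 := by
  by_contra! hlt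
  obtain ⟨Y, hYZ, hY⟩ := Finset.exists_subset_card_eq (Nat.succ_le_of_lt hlt)
  obtain ⟨w, hwI, hwm, hwZ⟩ := exists_interlacing hY fun z hz => (hZ z (hYZ hz)).1
  let x : Fin (d + 2) → ℝ := fun i => w (i + d % 2)
  have hx : StrictMono x := fun i j hij => hwm _ _ (by omega) (by omega)
  have hxI : ∀ i, x i ∈ Set.Icc a b := fun i => hwI _ (by omega)
  have hpos := hT x hx hxI
  rw [det_vandermonde_border_eq_sum d h c x] at hpos
  refine hpos.not_ge (Finset.sum_nonpos fun i _ => ?_)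
  have hV := det_vandermonde_pos_of_strictMono (hx.comp (Fin.strictMono_succAbove i))
  refine mul_nonpos_of_nonpos_of_nonneg ?_ hV.le
  by_cases hev : Even ((i : ℕ) + d % 2)
  · have := (hZ _ (hYZ (hwZ _ (by omega) hev))).2
    change h (x i) = _ at this
    rw [this]; simp [x]
  · have h1 : Even ((i : ℕ) + (d + 1)) := by
      rw [Nat.even_iff] at hev ⊢; omega
    rw [h1.neg_one_pow, one_mul]
    exact sub_nonpos.2 (hc _ (hxI i))

theorem integrable_of_continuousOn_of_compl_null {K : Set ℝ} (hK : IsCompact K) {f : ℝ → ℝ}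
    (hf : ContinuousOn f K) {σ : Measure ℝ} [IsFiniteMeasure σ] (hσ : σ Kᶜ = 0) :
    Integrable f σ := by
  have := hf.integrableOn_compact (μ := σ) hK
  rwa [IntegrableOn, Measure.restrict_eq_self_of_ae_mem (mem_ae_iff.2 hσ)] at this

/-- A nonzero finite measure carried by `K` is a multiple of a probability measure on `K`. -/
theorem exists_probabilityMeasure_integral_eq {K : Set ℝ} (hK : MeasurableSet K) {σ : Measure ℝ}
    [IsFiniteMeasure σ] (hσ : σ Kᶜ = 0) (hpos : 0 < σ.real Set.univ) :
    ∃ ν : ProbabilityMeasure K, ∀ f : ℝ → ℝ,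
      ∫ x, f x ∂σ = σ.real Set.univ * ∫ x : K, f x ∂(ν : Measure K) := by
  have hmap : (σ.comap ((↑) : K → ℝ)).map (↑) = σ := by
    rw [map_comap_subtype_coe hK, Measure.restrict_eq_self_of_ae_mem (mem_ae_iff.2 hσ)]
  have huniv : σ.comap ((↑) : K → ℝ) Set.univ = σ Set.univ := by
    conv_rhs => rw [← hmap]
    rw [Measure.map_apply measurable_subtype_coe MeasurableSet.univ, Set.preimage_univ]
  have h0 : σ Set.univ ≠ 0 := fun h => by simp [Measure.real, h] at hpos
  refine ⟨⟨(σ Set.univ)⁻¹ • σ.comap (↑), ⟨?_⟩⟩, fun f => ?_⟩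
  · rw [Measure.smul_apply, huniv, smul_eq_mul,
      ENNReal.inv_mul_cancel h0 (measure_ne_top _ _)]
  · change _ = _ * ∫ x : K, f x ∂((σ Set.univ)⁻¹ • σ.comap (↑))
    rw [integral_smul_measure, smul_eq_mul, ENNReal.toReal_inv, ← Measure.real, ← mul_assoc,
      mul_inv_cancel₀ hpos.ne', one_mul,
      ← (MeasurableEmbedding.subtype_coe hK).integral_map, hmap]

/-- On a compact set, the integral of a continuous function attains its maximum over the measures
with prescribed total mass and prescribed integrals of given continuous functions. -/
theorem exists_maximizer {K : Set ℝ} (hK : IsCompact K) {ι : Type*} (u : ι → ℝ → ℝ)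
    (hu : ∀ i, ContinuousOn (u i) K) {h : ℝ → ℝ} (hh : ContinuousOn h K)
    (σ₀ : Measure ℝ) [IsFiniteMeasure σ₀] (hσ₀ : σ₀ Kᶜ = 0) :
    ∃ σ : Measure ℝ, IsFiniteMeasure σ ∧ σ Kᶜ = 0 ∧
      (∀ i, ∫ x, u i x ∂σ = ∫ x, u i x ∂σ₀) ∧
      ∀ τ : Measure ℝ, IsFiniteMeasure τ → τ Kᶜ = 0 → τ.real Set.univ = σ₀.real Set.univ →
        (∀ i, ∫ x, u i x ∂τ = ∫ x, u i x ∂σ₀) → ∫ x, h x ∂τ ≤ ∫ x, h x ∂σ := by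
  rcases (measureReal_nonneg (μ := σ₀) (s := Set.univ)).eq_or_lt with h0 | hpos
  · have hz : ∀ τ : Measure ℝ, IsFiniteMeasure τ → τ.real Set.univ = 0 → τ = 0 := by
      intro τ _ hτ
      rwa [measureReal_eq_zero_iff, Measure.measure_univ_eq_zero] at hτ
    refine ⟨σ₀, inferInstance, hσ₀, fun _ => rfl, fun τ hτ _ hτm _ => ?_⟩
    rw [hz σ₀ inferInstance h0.symm, hz τ hτ (hτm.trans h0.symm)]
  set m := σ₀.real Set.univ
  have : CompactSpace K := isCompact_iff_compactSpace.1 hK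
  have hcts : ∀ f : ℝ → ℝ, ContinuousOn f K →
      Continuous fun ν : ProbabilityMeasure K => ∫ x : K, f x ∂(ν : Measure K) := fun f hf =>
    ProbabilityMeasure.continuous_integral_boundedContinuousFunction
      (BoundedContinuousFunction.mkOfCompact ⟨_, hf.domRestrict⟩)
  let S : Set (ProbabilityMeasure K) :=
    ⋂ i, {ν | m * ∫ x : K, u i x ∂(ν : Measure K) = ∫ x, u i x ∂σ₀}
  have hS : IsCompact S := (isClosed_iInter fun i =>
    isClosed_eq (continuous_const.mul (hcts _ (hu i))) continuous_const).isCompact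
  obtain ⟨ν₀, hν₀⟩ := exists_probabilityMeasure_integral_eq hK.measurableSet hσ₀ hpos
  have hne : S.Nonempty := ⟨ν₀, Set.mem_iInter.2 fun i => (hν₀ _).symm⟩
  obtain ⟨ν, hνS, hν⟩ := hS.exists_isMaxOn hne (hcts h hh).continuousOn
  have hemb := MeasurableEmbedding.subtype_coe hK.measurableSet
  have hInt : ∀ f : ℝ → ℝ, ∫ x, f x ∂(m.toNNReal • (ν : Measure K).map (↑)) =
      m * ∫ x : K, f x ∂(ν : Measure K) := fun f => by
    rw [integral_smul_nnreal_measure, hemb.integral_map, NNReal.smul_def,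
      Real.coe_toNNReal _ hpos.le, smul_eq_mul]
  refine ⟨m.toNNReal • (ν : Measure K).map (↑), inferInstance, ?_, fun i => ?_,
    fun τ hτ hτK hτm hτu => ?_⟩
  · rw [Measure.smul_apply, hemb.map_apply]
    simp
  · rw [hInt]; exact Set.mem_iInter.1 hνS i
  · obtain ⟨ν', hν'⟩ := exists_probabilityMeasure_integral_eq hK.measurableSet hτK
      (hτm ▸ hpos)
    rw [hInt, hν', hτm]
    refine mul_le_mul_of_nonneg_left (hν (Set.mem_iInter.2 fun i => ?_)) hpos.le
    rw [Set.mem_ofPred_eq, ← hτu i, hν', hτm]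

/-- Duality: if the moment vector of `σ` is interior to the moment space and `σ` maximizes
`∫ h` among the measures with the same moments, then some linear combination of the `u i`
majorizes `h` on `K` with equal integral against `σ`. -/
theorem exists_dual_certificate {K : Set ℝ} (hK : IsCompact K) {ι : Type*} [Fintype ι]
    (u : ι → ℝ → ℝ) (hu : ∀ i, ContinuousOn (u i) K) {h : ℝ → ℝ} (hh : ContinuousOn h K)
    (k : ι → ℝ) (hk : ∀ x ∈ K, ∑ i, k i * u i x ≤ h x)
    (σ : Measure ℝ) [IsFiniteMeasure σ] (hσ : σ Kᶜ = 0)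
    (hmax : ∀ τ : Measure ℝ, IsFiniteMeasure τ → τ Kᶜ = 0 →
        (∀ i, ∫ x, u i x ∂τ = ∫ x, u i x ∂σ) → ∫ x, h x ∂τ ≤ ∫ x, h x ∂σ)
    (hInt : (fun i => ∫ x, u i x ∂σ) ∈ interior {v : ι → ℝ | ∃ τ : Measure ℝ,
      IsFiniteMeasure τ ∧ τ Kᶜ = 0 ∧ ∀ i, ∫ x, u i x ∂τ = v i}) :
    ∃ c : ι → ℝ, (∀ x ∈ K, h x ≤ ∑ i, c i * u i x) ∧
      ∫ x, h x ∂σ = ∑ i, c i * ∫ x, u i x ∂σ := by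
  classical
  set W := {v : ι → ℝ | ∃ τ : Measure ℝ,
      IsFiniteMeasure τ ∧ τ Kᶜ = 0 ∧ ∀ i, ∫ x, u i x ∂τ = v i}
  set p : ι → ℝ := fun i => ∫ x, u i x ∂σ
  let A : Set ((ι → ℝ) × ℝ) := {q | ∃ τ : Measure ℝ, IsFiniteMeasure τ ∧ τ Kᶜ = 0 ∧
    (∀ i, ∫ x, u i x ∂τ = q.1 i) ∧ q.2 ≤ ∫ x, h x ∂τ}
  have hI : ∀ f : ℝ → ℝ, ContinuousOn f K → ∀ τ : Measure ℝ, IsFiniteMeasure τ → τ Kᶜ = 0 →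
      Integrable f τ := fun f hf τ _ hτ => integrable_of_continuousOn_of_compl_null hK hf hτ
  have hA : Convex ℝ A := by
    rintro q ⟨τ, hτ, hτK, hτu, hτh⟩ q' ⟨τ', hτ', hτK', hτu', hτh'⟩ s t hs ht -
    have hcomb : ∀ f : ℝ → ℝ, ContinuousOn f K →
        ∫ x, f x ∂(s.toNNReal • τ + t.toNNReal • τ') =
          s * ∫ x, f x ∂τ + t * ∫ x, f x ∂τ' := fun f hf => by
      rw [integral_add_measure ((hI f hf τ hτ hτK).smul_measure_nnreal)
        ((hI f hf τ' hτ' hτK').smul_measure_nnreal), integral_smul_nnreal_measure,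
        integral_smul_nnreal_measure, NNReal.smul_def, NNReal.smul_def,
        Real.coe_toNNReal _ hs, Real.coe_toNNReal _ ht, smul_eq_mul, smul_eq_mul]
    refine ⟨s.toNNReal • τ + t.toNNReal • τ', inferInstance, by simp [hτK, hτK'],
      fun i => ?_, ?_⟩
    · rw [hcomb _ (hu i), hτu, hτu']; simp
    · rw [hcomb _ hh]
      exact add_le_add (mul_le_mul_of_nonneg_left hτh hs) (mul_le_mul_of_nonneg_left hτh' ht)
  have hsum : ∀ (c : ι → ℝ) (τ : Measure ℝ), IsFiniteMeasure τ → τ Kᶜ = 0 →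
      ∫ x, ∑ i, c i * u i x ∂τ = ∑ i, c i * ∫ x, u i x ∂τ := fun c τ hτ hτK => by
    rw [integral_finsetSum _ fun i _ => (hI _ (hu i) τ hτ hτK).const_mul _]
    simp_rw [integral_const_mul]
  have hsub : interior W ×ˢ Set.univ ∩ {q | q.2 < ∑ i, k i * q.1 i} ⊆ A := by
    rintro ⟨v, t⟩ ⟨⟨hv, -⟩, ht⟩
    obtain ⟨τ, hτ, hτK, hτu⟩ := interior_subset hv
    replace hτu : ∀ i, ∫ x, u i x ∂τ = v i := hτu
    replace ht : t < ∑ i, k i * v i := ht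
    refine ⟨τ, hτ, hτK, hτu, ht.le.trans ?_⟩
    simp_rw [← hτu]
    rw [← hsum k τ hτ hτK]
    refine integral_mono_ae (integrable_finsetSum _ fun i _ =>
      (hI _ (hu i) τ hτ hτK).const_mul _) (hI h hh τ hτ hτK) ?_
    filter_upwards [mem_ae_iff.2 hτK] with x hx using hk x hx
  have hopen : IsOpen (interior W ×ˢ Set.univ ∩ {q : (ι → ℝ) × ℝ | q.2 < ∑ i, k i * q.1 i}) :=
    (isOpen_interior.prod isOpen_univ).inter (isOpen_lt (by fun_prop) (by fun_prop))
  have hne : (interior A).Nonempty :=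
    ⟨(p, ∑ i, k i * p i - 1), interior_maximal hsub hopen ⟨⟨hInt, trivial⟩, by simp⟩⟩
  have hnot : (p, ∫ x, h x ∂σ) ∉ interior A := by
    intro hmem
    have h1 : ∀ᶠ t in nhds (∫ x, h x ∂σ), (p, t) ∈ A :=
      (Continuous.prodMk_right p).continuousAt.preimage_mem_nhds (mem_interior_iff_mem_nhds.1 hmem)
    obtain ⟨t, ⟨τ, hτ, hτK, hτu, hτh⟩, ht⟩ :=
      ((h1.filter_mono nhdsWithin_le_nhds).and
        (self_mem_nhdsWithin : Set.Ioi (∫ x, h x ∂σ) ∈ _)).exists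
    exact (hmax τ hτ hτK hτu).not_gt (lt_of_lt_of_le ht hτh)
  obtain ⟨f, hf0, hf⟩ := geometric_hahn_banach_of_nonempty_interior_point hA hnot hne
  obtain ⟨φ, hφ⟩ : ∃ φ : ι → ℝ, ∀ i, φ i = f (fun j => if i = j then 1 else 0, 0) :=
    ⟨_, fun _ => rfl⟩
  set s := f (0, 1) with hs
  have hfeq : ∀ v t, f (v, t) = ∑ i, φ i * v i + t * s := by
    intro v t
    have h1 : f (v, t) = f (v, 0) + t * f (0, 1) := by
      rw [← smul_eq_mul, ← map_smul, ← map_add]; simp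
    have h2 := LinearMap.pi_apply_eq_sum_univ
      (f.toLinearMap.comp (LinearMap.inl ℝ (ι → ℝ) ℝ)) v
    simp only [LinearMap.comp_apply, LinearMap.inl_apply, ContinuousLinearMap.coe_coe,
      smul_eq_mul] at h2
    rw [h1, h2]
    simp_rw [hφ, hs, mul_comm]
  have hs0 : 0 ≤ s := by
    have := hf (p, ∫ x, h x ∂σ - 1) ⟨σ, inferInstance, hσ, fun _ => rfl, by linarith⟩
    rw [hfeq, hfeq] at this
    linarith
  have hspos : 0 < s := by
    refine hs0.lt_of_ne fun h0 => hf0 ?_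
    have hle : ∀ v ∈ W, ∑ i, φ i * v i ≤ ∑ i, φ i * p i := by
      rintro v ⟨τ, hτ, hτK, hτu⟩
      have := hf (v, ∫ x, h x ∂τ) ⟨τ, hτ, hτK, hτu, le_rfl⟩
      rwa [hfeq, hfeq, ← h0, mul_zero, mul_zero, add_zero, add_zero] at this
    have hφ0 : ∀ i, φ i = 0 := by
      have hcont : Continuous fun ε : ℝ => p + ε • φ := by fun_prop
      have h1 : ∀ᶠ ε in nhds (0 : ℝ), p + ε • φ ∈ W :=
        hcont.continuousAt.preimage_mem_nhds (by
          simpa using mem_interior_iff_mem_nhds.1 hInt)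
      obtain ⟨ε, hε, hεpos⟩ := ((h1.filter_mono nhdsWithin_le_nhds).and
        (self_mem_nhdsWithin : Set.Ioi (0 : ℝ) ∈ _)).exists
      have h2 := hle _ hε
      have h3 : ∑ i, φ i * (p + ε • φ) i = ∑ i, φ i * p i + ε * ∑ i, φ i * φ i := by
        rw [Finset.mul_sum, ← Finset.sum_add_distrib]
        exact Finset.sum_congr rfl fun i _ => by simp; ring
      have h4 : ∑ i, φ i * φ i ≤ 0 := by
        by_contra! hlt
        have := mul_pos (Set.mem_Ioi.1 hεpos) hlt
        linarith
      have h5 := (Finset.sum_eq_zero_iff_of_nonneg fun i _ => mul_self_nonneg (φ i)).1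
        (h4.antisymm (Finset.sum_nonneg fun i _ => mul_self_nonneg (φ i)))
      exact fun i => mul_self_eq_zero.1 (h5 i (Finset.mem_univ i))
    ext q
    · simp [hfeq, hφ0]
    · simp [hfeq, ← h0]
  have hscale : ∀ τ : Measure ℝ, IsFiniteMeasure τ → τ Kᶜ = 0 → ∀ r : NNReal,
      (r : ℝ) * (∑ i, φ i * ∫ x, u i x ∂τ + (∫ x, h x ∂τ) * s) ≤
        ∑ i, φ i * p i + (∫ x, h x ∂σ) * s := by
    intro τ hτ hτK r
    have := hf (fun i => ∫ x, u i x ∂(r • τ), ∫ x, h x ∂(r • τ))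
      ⟨r • τ, inferInstance, by simp [hτK], fun _ => rfl, le_rfl⟩
    rw [hfeq, hfeq] at this
    simp_rw [integral_smul_nnreal_measure, NNReal.smul_def, smul_eq_mul] at this
    refine le_of_eq_of_le ?_ this
    rw [mul_add, Finset.mul_sum, mul_assoc]
    congr 1
    exact Finset.sum_congr rfl fun i _ => by ring
  have hzero : ∑ i, φ i * p i + (∫ x, h x ∂σ) * s = 0 := by
    have h1 := hscale σ inferInstance hσ 0
    have h2 := hscale σ inferInstance hσ 2
    simp only [NNReal.coe_zero, zero_mul, NNReal.coe_ofNat] at h1 h2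
    change 2 * (∑ i, φ i * p i + (∫ x, h x ∂σ) * s) ≤ _ at h2
    linarith
  have hdiv : ∀ v : ι → ℝ, (∑ i, -(φ i / s) * v i) = -(∑ i, φ i * v i) / s := fun v => by
    rw [← Finset.sum_neg_distrib, Finset.sum_div]
    exact Finset.sum_congr rfl fun i _ => by ring
  refine ⟨fun i => -(φ i / s), fun x hx => ?_, ?_⟩
  · have h1 := hscale (Measure.dirac x) inferInstance (by
      rw [Measure.dirac_apply' _ hK.measurableSet.compl]; simp [hx]) 1
    simp only [integral_dirac, NNReal.coe_one, one_mul, hzero] at h1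
    rw [hdiv, le_div_iff₀ hspos]
    linarith
  · rw [hdiv, eq_div_iff hspos.ne']
    linarith

/-- Markov–Krein / Karlin–Studden theorem. Let `𝒱(M̄_d)` be the (nonempty) set of
positive measures on `[a,b]` with moments `∫ x^m dσ = M_m` for `m = 0,…,d`, and let
`h` be continuous on `[a,b]` such that `(1, x, …, x^d, h)` is a Tchebycheff system.
Then `sup_{σ ∈ 𝒱} ∫ h dσ` is finite and, if `M̄_d` is interior to the moment space,
it is attained by a discrete measure supported on at most `⌈d/2⌉ + 1` points, one of
which is `b` (the upper principal representation). -/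
theorem stmt17 (a b : ℝ) (hab : a < b) (d : ℕ) (M : ℕ → ℝ)
    (V : Set (Measure ℝ))
    (hV : V = {σ : Measure ℝ | IsFiniteMeasure σ ∧ σ (Set.Icc a b)ᶜ = 0 ∧
      ∀ m ≤ d, (∫ x, x ^ m ∂σ) = M m})
    (hVne : V.Nonempty)
    (h : ℝ → ℝ) (hcont : ContinuousOn h (Set.Icc a b))
    (hT : ∀ x : Fin (d + 2) → ℝ, StrictMono x → (∀ i, x i ∈ Set.Icc a b) →
      0 < Matrix.det (Matrix.of fun i j : Fin (d + 2) =>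
        if (j : ℕ) ≤ d then x i ^ (j : ℕ) else h (x i))) :
    BddAbove ((fun σ => ∫ x, h x ∂σ) '' V) ∧
    ((fun m : Fin (d + 1) => M (m : ℕ)) ∈ interior
        {v : Fin (d + 1) → ℝ | ∃ σ : Measure ℝ, IsFiniteMeasure σ ∧
          σ (Set.Icc a b)ᶜ = 0 ∧ ∀ m : Fin (d + 1), (∫ x, x ^ (m : ℕ) ∂σ) = v m} →
      ∃ σ ∈ V, ∃ s : Finset ℝ, s.card ≤ (d + 1) / 2 + 1 ∧ b ∈ s ∧
        σ (↑s : Set ℝ)ᶜ = 0 ∧ ∀ τ ∈ V, (∫ x, h x ∂τ) ≤ ∫ x, h x ∂σ) := by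
  subst hV
  have hK : IsCompact (Set.Icc a b) := isCompact_Icc
  obtain ⟨σ₀, hσ₀, hσ₀K, hσ₀M⟩ := hVne
  have hu : ∀ i : Fin (d + 1), ContinuousOn (fun x : ℝ => x ^ (i : ℕ)) (Set.Icc a b) :=
    fun i => (continuous_pow _).continuousOn
  have hmass : ∀ τ : Measure ℝ, τ.real Set.univ = ∫ x, x ^ 0 ∂τ := fun τ => by simp
  have hM : ∀ i : Fin (d + 1), (i : ℕ) ≤ d := fun i => Nat.le_of_lt_succ i.2
  obtain ⟨σ, hσ, hσK, hσu, hmax⟩ :=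
    exists_maximizer hK (fun (i : Fin (d + 1)) x => x ^ (i : ℕ)) hu hcont σ₀ hσ₀K
  have hσM : ∀ m ≤ d, ∫ x, x ^ m ∂σ = M m := fun m hm => by
    rw [← hσ₀M m hm]; exact hσu ⟨m, Nat.lt_succ_of_le hm⟩
  have hmaxV : ∀ τ : Measure ℝ, IsFiniteMeasure τ → τ (Set.Icc a b)ᶜ = 0 →
      (∀ m ≤ d, ∫ x, x ^ m ∂τ = M m) → ∫ x, h x ∂τ ≤ ∫ x, h x ∂σ := fun τ hτ hτK hτM =>
    hmax τ hτ hτK (by rw [hmass, hmass, hτM 0 d.zero_le, hσ₀M 0 d.zero_le])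
      fun i => by rw [hτM _ (hM i), hσ₀M _ (hM i)]
  refine ⟨⟨∫ x, h x ∂σ, ?_⟩, fun hInt => ?_⟩
  · rintro _ ⟨τ, ⟨hτ, hτK, hτM⟩, rfl⟩
    exact hmaxV τ hτ hτK hτM
  obtain ⟨C, hC⟩ := hK.exists_bound_of_continuousOn hcont
  obtain ⟨c, hc, hceq⟩ := exists_dual_certificate hK
    (fun (i : Fin (d + 1)) x => x ^ (i : ℕ)) hu hcont (fun i => if i = 0 then -C else 0)
    (fun x hx => by simpa using (abs_le.1 (hC x hx)).1) σ hσK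
    (fun τ hτ hτK hτu => hmaxV τ hτ hτK fun m hm => by
      rw [← hσM m hm]; exact hτu ⟨m, Nat.lt_succ_of_le hm⟩)
    (by simpa only [hσM _ (hM _)] using hInt)
  have hcount := card_contact_le a b d h hT c hc
  let Z : Set ℝ := {z | z ∈ Set.Ico a b ∧ h z = ∑ j, c j * z ^ (j : ℕ)}
  have hZfin : Z.Finite := by
    by_contra hinf
    obtain ⟨Y, hYZ, hY⟩ := Set.Infinite.exists_subset_card_eq hinf ((d + 1) / 2 + 1)
    have := hcount Y fun z hz => hYZ hz
    omega
  refine ⟨σ, ⟨hσ, hσK, hσM⟩, insert b hZfin.toFinset,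
    (Finset.card_insert_le _ _).trans (Nat.succ_le_succ (hcount _ fun z hz => by simpa [Z] using hz)),
    Finset.mem_insert_self _ _, ?_, fun τ ⟨hτ, hτK, hτM⟩ => hmaxV τ hτ hτK hτM⟩
  have hsupp : ∀ᵐ x ∂σ, x ∈ Set.Icc a b := mem_ae_iff.2 hσK
  have hterm : ∀ i ∈ (Finset.univ : Finset (Fin (d + 1))),
      Integrable (fun x => c i * x ^ (i : ℕ)) σ := fun i _ =>
    (integrable_of_continuousOn_of_compl_null hK (hu i) hσK).const_mul _
  have hPint : Integrable (fun x => ∑ i, c i * x ^ (i : ℕ)) σ := integrable_finsetSum _ hterm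
  have hhint := integrable_of_continuousOn_of_compl_null hK hcont hσK
  have hzero : ∫ x, ((fun x => ∑ i, c i * x ^ (i : ℕ)) - h) x ∂σ = 0 := by
    rw [integral_sub' hPint hhint, integral_finsetSum _ hterm, hceq]
    simp_rw [integral_const_mul, sub_self]
  rw [integral_eq_zero_iff_of_nonneg_ae
    (by filter_upwards [hsupp] with x hx using sub_nonneg.2 (hc x hx)) (hPint.sub hhint)] at hzero
  refine mem_ae_iff.1 ?_
  filter_upwards [hsupp, hzero] with x hx hx0
  rcases hx.2.eq_or_lt with rfl | hlt
  · simp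
  · exact Finset.mem_insert_of_mem
      (hZfin.mem_toFinset.2 ⟨⟨hx.1, hlt⟩, (sub_eq_zero.1 hx0).symm⟩)
end

section
/- If the vector (M_0, M_1, …, M_d) lies on the boundary of the moment space 𝓜_{d+1} for the system (1, x, …, x^d) on [a,b], then it has a unique representation as a finitely supported positive measure, and conversely, existence of a representation with index at most d/2 implies the vector is a boundary point of 𝓜_{d+1}. -/
open MeasureTheory Classical

/-- In finite dimension, the convex hull of a compact set is compact. -/
theorem IsCompact.convexHull_of_finiteDimensional {E : Type*} [NormedAddCommGroup E]
    [NormedSpace ℝ E] [FiniteDimensional ℝ E] {s : Set E} (hs : IsCompact s) :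
    IsCompact (convexHull ℝ s) := by
  obtain rfl | ⟨x₀, hx₀⟩ := s.eq_empty_or_nonempty
  · simp
  let N := Module.finrank ℝ E + 1
  let g : (Fin N → ℝ) × (Fin N → E) → E := fun p => ∑ i, p.1 i • p.2 i
  have hg : Continuous g := by fun_prop
  have himage : convexHull ℝ s = g '' (stdSimplex ℝ (Fin N) ×ˢ Set.univ.pi fun _ => s) := by
    apply Set.Subset.antisymm
    · intro x hx
      obtain ⟨ι, _, z, w, hz, hind, hw, hsum, rfl⟩ := eq_pos_convex_span_of_mem_convexHull hx
      have hcard : Fintype.card ι ≤ Fintype.card (Fin N) := by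
        simpa [N] using hind.card_le_finrank_succ.trans
          (Nat.succ_le_succ (Submodule.finrank_le _))
      obtain ⟨e⟩ := Function.Embedding.nonempty_of_card_le hcard
      have hwe : ∀ i, Function.extend e w 0 (e i) = w i := e.injective.extend_apply w 0
      have hze : ∀ i, Function.extend e z (fun _ => x₀) (e i) = z i := e.injective.extend_apply z _
      have hwn : ∀ j, j ∉ Set.range e → Function.extend e w 0 j = 0 := fun j hj =>
        Function.extend_apply' _ _ _ hj
      refine ⟨(Function.extend e w 0, Function.extend e z fun _ => x₀), ⟨⟨?_, ?_⟩, ?_⟩, ?_⟩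
      · intro j
        by_cases hj : j ∈ Set.range e
        · obtain ⟨i, rfl⟩ := hj
          exact (hw i).le.trans_eq (hwe i).symm
        · exact (hwn j hj).ge
      · rw [← hsum]
        exact (Fintype.sum_of_injective e e.injective _ _ hwn fun i => (hwe i).symm).symm
      · intro j _
        by_cases hj : j ∈ Set.range e
        · obtain ⟨i, rfl⟩ := hj
          simpa [hze] using hz ⟨i, rfl⟩
        · simpa [Function.extend_apply' _ _ _ hj] using hx₀
      · refine (Fintype.sum_of_injective e e.injective _ _ ?_ ?_).symm
        · intro j hj
          simp [hwn j hj]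
        · intro i
          simp [hwe, hze]
    · rintro _ ⟨⟨w, z⟩, ⟨hw, hz⟩, rfl⟩
      exact (convex_convexHull ℝ s).sum_mem (fun i _ => hw.1 i) hw.2
        fun i _ => subset_convexHull ℝ s (hz i trivial)
  rw [himage]
  exact ((isCompact_stdSimplex ℝ (Fin N)).prod (isCompact_univ_pi fun _ => hs)).image hg

/-- A convex set containing `0` in a finite-dimensional space is supported by a hyperplane at each
of its points outside the interior. -/
theorem Convex.exists_supporting_functional {E : Type*} [NormedAddCommGroup E]
    [NormedSpace ℝ E] [FiniteDimensional ℝ E] {S : Set E} (hS : Convex ℝ S) (h0 : (0 : E) ∈ S)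
    {x : E} (hxS : x ∈ S) (hx : x ∉ interior S) :
    ∃ f : E →ₗ[ℝ] ℝ, f ≠ 0 ∧ ∀ a ∈ S, f a ≤ f x := by
  by_cases hint : (interior S).Nonempty
  · obtain ⟨f, hf, hle⟩ := geometric_hahn_banach_of_nonempty_interior_point hS hx hint
    exact ⟨f.toLinearMap, fun h => hf (ContinuousLinearMap.coe_injective h), hle⟩
  · have hspan : Submodule.span ℝ S < ⊤ := by
      rw [lt_top_iff_ne_top]
      intro htop
      apply hint
      rw [hS.interior_nonempty_iff_affineSpan_eq_top, ← Set.insert_eq_of_mem h0,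
        ← AffineSubspace.coe_eq_univ_iff, affineSpan_insert_zero, htop]
      rfl
    obtain ⟨f, hf, hle⟩ := Submodule.exists_le_ker_of_lt_top _ hspan
    have hzero : ∀ a ∈ S, f a = 0 := fun a ha => hle (Submodule.subset_span ha)
    exact ⟨f, hf, fun a ha => by rw [hzero a ha, hzero x hxS]⟩

/-- The moment curve `x ↦ (1, x, …, x ^ d)`. -/
def momentCurve (d : ℕ) (x : ℝ) : Fin (d + 1) → ℝ := fun m => x ^ (m : ℕ)

/-- The vectors of moments up to order `d` of finite measures on `[a, b]`. -/
def momentSpace (a b : ℝ) (d : ℕ) : Set (Fin (d + 1) → ℝ) :=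
  {v | ∃ σ : Measure ℝ, IsFiniteMeasure σ ∧
      σ (Set.Icc a b)ᶜ = 0 ∧ ∀ m : Fin (d + 1), (∫ x, x ^ (m : ℕ) ∂σ) = v m}

theorem continuous_momentCurve (d : ℕ) : Continuous (momentCurve d) := by
  unfold momentCurve
  fun_prop

theorem Continuous.integrable_of_measure_compl_Icc_eq_zero {E : Type*} [NormedAddCommGroup E]
    {a b : ℝ} {σ : Measure ℝ} [IsFiniteMeasure σ] (hσ : σ (Set.Icc a b)ᶜ = 0) {g : ℝ → E}
    (hg : Continuous g) : Integrable g σ := by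
  have h : IntegrableOn g (Set.Icc a b) σ := hg.continuousOn.integrableOn_compact isCompact_Icc
  have hrestrict : σ.restrict (Set.Icc a b) = σ :=
    Measure.restrict_eq_self_of_ae_mem (mem_ae_iff.2 hσ)
  rwa [IntegrableOn, hrestrict] at h

section MomentSpace

variable {a b : ℝ} {d : ℕ}

theorem sum_smul_momentCurve_mem_momentSpace {ι : Type*} (s : Finset ι) (w z : ι → ℝ)
    (hw : ∀ i ∈ s, 0 ≤ w i) (hz : ∀ i ∈ s, z i ∈ Set.Icc a b) :
    ∑ i ∈ s, w i • momentCurve d (z i) ∈ momentSpace a b d := by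
  refine ⟨∑ i ∈ s, ENNReal.ofReal (w i) • Measure.dirac (z i), ⟨?_⟩, ?_, fun m => ?_⟩
  · simp [Measure.finsetSum_apply, ENNReal.sum_lt_top]
  · rw [Measure.finsetSum_apply]
    refine Finset.sum_eq_zero fun i hi => ?_
    simp [Measure.dirac_apply' _ measurableSet_Icc.compl, hz i hi]
  · rw [integral_finsetSum_measure fun i _ =>
      (integrable_dirac (by simp)).smul_measure ENNReal.ofReal_ne_top]
    simp only [integral_smul_measure, integral_dirac, Finset.sum_apply, Pi.smul_apply, momentCurve]
    exact Finset.sum_congr rfl fun i hi => by rw [ENNReal.toReal_ofReal (hw i hi)]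

theorem momentSpace_subset_cone (hab : a ≤ b) :
    momentSpace a b d ⊆
      {v | 0 ≤ v 0 ∧ ∃ k ∈ convexHull ℝ (momentCurve d '' Set.Icc a b), v = v 0 • k} := by
  rintro v ⟨σ, _, hσ, hv⟩
  have hv0 : v 0 = σ.real Set.univ := by simp [← hv 0]
  obtain rfl | hne := eq_or_ne σ 0
  · have hv' : v = 0 := by
      ext m
      simp [← hv m]
    exact ⟨by simp [hv'], _, subset_convexHull ℝ _ ⟨a, Set.left_mem_Icc.2 hab, rfl⟩, by simp [hv']⟩
  have : NeZero σ := ⟨hne⟩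
  have hint := (continuous_momentCurve d).integrable_of_measure_compl_Icc_eq_zero hσ
  have hvi : v = ∫ x, momentCurve d x ∂σ := by
    ext m
    rw [← hv m, eval_integral fun i => hint.eval i]
    rfl
  refine ⟨hv0 ▸ measureReal_nonneg, ⨍ x, momentCurve d x ∂σ, ?_, ?_⟩
  · refine (convex_convexHull ℝ _).average_mem
      (isCompact_Icc.image (continuous_momentCurve d)).convexHull_of_finiteDimensional.isClosed
      ?_ hint
    filter_upwards [mem_ae_iff.2 hσ] with x hx
    exact subset_convexHull ℝ _ ⟨x, hx, rfl⟩
  · rw [hv0, measure_smul_average, hvi]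

theorem exists_finset_of_mem_cone {v : Fin (d + 1) → ℝ} (h0 : 0 ≤ v 0)
    (hv : ∃ k ∈ convexHull ℝ (momentCurve d '' Set.Icc a b), v = v 0 • k) :
    ∃ (s : Finset ℝ) (w : ℝ → ℝ), (s : Set ℝ) ⊆ Set.Icc a b ∧ (∀ x ∈ s, 0 < w x) ∧
      v = ∑ x ∈ s, w x • momentCurve d x := by
  obtain ⟨k, hk, hvk⟩ := hv
  rw [convexHull_eq_union_convexHull_finite_subsets] at hk
  simp only [Set.mem_iUnion] at hk
  obtain ⟨t, ht, hk⟩ := hk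
  obtain ⟨w, hw, -, hwk⟩ := Finset.mem_convexHull'.1 hk
  choose! g hg hgt using ht
  have hinj : Set.InjOn g t := fun x hx y hy h => by rw [← hgt hx, ← hgt hy, h]
  let u : ℝ → ℝ := fun x => v 0 * w (momentCurve d x)
  have hu : ∀ x ∈ t.image g, 0 ≤ u x := by
    intro x hx
    obtain ⟨y, hy, rfl⟩ := Finset.mem_image.1 hx
    simp only [u, hgt (Finset.mem_coe.2 hy)]
    exact mul_nonneg h0 (hw y hy)
  refine ⟨(t.image g).filter fun x => 0 < u x, u, ?_, ?_, ?_⟩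
  · intro x hx
    obtain ⟨y, hy, rfl⟩ := Finset.mem_image.1 (Finset.mem_filter.1 hx).1
    exact hg hy
  · exact fun x hx => (Finset.mem_filter.1 hx).2
  · rw [Finset.sum_filter_of_ne fun x hx hne =>
      (hu x hx).lt_of_ne fun h => hne (by rw [← h, zero_smul]), Finset.sum_image hinj, hvk, ← hwk,
      Finset.smul_sum]
    refine Finset.sum_congr rfl fun y hy => ?_
    simp only [u, hgt (Finset.mem_coe.2 hy), mul_smul]

theorem isClosed_momentCone :
    IsClosed {v : Fin (d + 1) → ℝ |
      0 ≤ v 0 ∧ ∃ k ∈ convexHull ℝ (momentCurve d '' Set.Icc a b), v = v 0 • k} := by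
  have hK := (isCompact_Icc (a := a) (b := b)).image (continuous_momentCurve d)
    |>.convexHull_of_finiteDimensional
  have : CompactSpace (convexHull ℝ (momentCurve d '' Set.Icc a b)) :=
    isCompact_iff_compactSpace.1 hK
  have hc : IsClosed {p : (Fin (d + 1) → ℝ) × convexHull ℝ (momentCurve d '' Set.Icc a b) |
      0 ≤ p.1 0 ∧ p.1 = p.1 0 • (p.2 : Fin (d + 1) → ℝ)} :=
    (isClosed_le continuous_const (by fun_prop : Continuous fun p : (Fin (d + 1) → ℝ) ×
      convexHull ℝ (momentCurve d '' Set.Icc a b) => p.1 0)).and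
      (isClosed_eq (by fun_prop) (by fun_prop))
  convert isClosedMap_fst_of_compactSpace _ hc using 1
  ext v
  simp

theorem momentSpace_eq_cone (hab : a ≤ b) :
    momentSpace a b d =
      {v | 0 ≤ v 0 ∧ ∃ k ∈ convexHull ℝ (momentCurve d '' Set.Icc a b), v = v 0 • k} := by
  refine (momentSpace_subset_cone hab).antisymm fun v hv => ?_
  obtain ⟨s, w, hs, hw, hv⟩ := exists_finset_of_mem_cone hv.1 hv.2
  rw [hv]
  exact sum_smul_momentCurve_mem_momentSpace s w _ (fun x hx => (hw x hx).le) fun x hx => hs hx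

theorem isClosed_momentSpace (hab : a ≤ b) : IsClosed (momentSpace a b d) :=
  momentSpace_eq_cone (d := d) hab ▸ isClosed_momentCone

/-- Every moment vector is represented by a finitely supported measure. -/
theorem exists_finset_of_mem_momentSpace (hab : a ≤ b) {v : Fin (d + 1) → ℝ}
    (hv : v ∈ momentSpace a b d) :
    ∃ (s : Finset ℝ) (w : ℝ → ℝ), (s : Set ℝ) ⊆ Set.Icc a b ∧ (∀ x ∈ s, 0 < w x) ∧
      v = ∑ x ∈ s, w x • momentCurve d x := by
  rw [momentSpace_eq_cone hab] at hv
  exact exists_finset_of_mem_cone hv.1 hv.2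

theorem add_smul_mem_momentSpace (hab : a ≤ b) {v w : Fin (d + 1) → ℝ}
    (hv : v ∈ momentSpace a b d) (hw : w ∈ momentSpace a b d) {α β : ℝ} (hα : 0 ≤ α)
    (hβ : 0 ≤ β) : α • v + β • w ∈ momentSpace a b d := by
  obtain ⟨s, f, hs, hf, rfl⟩ := exists_finset_of_mem_momentSpace hab hv
  obtain ⟨t, g, ht, hg, rfl⟩ := exists_finset_of_mem_momentSpace hab hw
  have h := sum_smul_momentCurve_mem_momentSpace (a := a) (b := b) (d := d) (s.disjSum t)
    (Sum.elim (fun x => α * f x) fun x => β * g x) (Sum.elim id id)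
    (by
      rintro (x | x) hx
      · exact mul_nonneg hα (hf x (by simpa using hx)).le
      · exact mul_nonneg hβ (hg x (by simpa using hx)).le)
    (by
      rintro (x | x) hx
      · exact hs (by simpa using hx)
      · exact ht (by simpa using hx))
  simpa [Finset.sum_disjSum, Finset.smul_sum, mul_smul] using h

theorem zero_mem_momentSpace : (0 : Fin (d + 1) → ℝ) ∈ momentSpace a b d := by
  simpa using sum_smul_momentCurve_mem_momentSpace (a := a) (b := b) (d := d)
    (∅ : Finset ℝ) 0 id (by simp) (by simp)

theorem momentCurve_mem_momentSpace {x : ℝ} (hx : x ∈ Set.Icc a b) :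
    momentCurve d x ∈ momentSpace a b d := by
  simpa using sum_smul_momentCurve_mem_momentSpace (a := a) (b := b) (d := d)
    {x} 1 id (by simp) (by simpa using hx)

/-- A boundary vector of the moment space is annihilated by a nonzero polynomial of degree at most
`d` that is nonpositive on `[a, b]`. -/
theorem exists_polynomial_of_mem_frontier (hab : a ≤ b) {v : Fin (d + 1) → ℝ}
    (hv : v ∈ frontier (momentSpace a b d)) :
    ∃ (f : (Fin (d + 1) → ℝ) →ₗ[ℝ] ℝ) (P : Polynomial ℝ), P ≠ 0 ∧ P.natDegree ≤ d ∧
      (∀ x, f (momentCurve d x) = P.eval x) ∧ (∀ x ∈ Set.Icc a b, P.eval x ≤ 0) ∧ f v = 0 := by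
  have hvS : v ∈ momentSpace a b d := (isClosed_momentSpace hab).frontier_subset hv
  obtain ⟨f, hf, hle⟩ := Convex.exists_supporting_functional
    (fun v hv w hw α β hα hβ _ => add_smul_mem_momentSpace hab hv hw hα hβ)
    zero_mem_momentSpace hvS hv.2
  have hfv : f v = 0 := by
    have h₀ := hle 0 zero_mem_momentSpace
    have h₂ := hle _ (add_smul_mem_momentSpace hab hvS hvS zero_le_one zero_le_one)
    simp only [map_zero, map_add, one_smul] at h₀ h₂
    linarith
  let c : Fin (d + 1) → ℝ := fun m => f (Pi.single m 1)
  have hdeg : (Polynomial.ofFn (d + 1) c).natDegree < d + 1 :=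
    Polynomial.ofFn_natDegree_lt (by omega) c
  have hcoeff : ∀ m : Fin (d + 1), (Polynomial.ofFn (d + 1) c).coeff m = c m := fun m =>
    Polynomial.ofFn_coeff_eq_val_of_lt c m.2
  have heval : ∀ x, f (momentCurve d x) = (Polynomial.ofFn (d + 1) c).eval x := by
    intro x
    rw [Polynomial.eval_eq_sum_range' hdeg, Finset.sum_range, LinearMap.pi_apply_eq_sum_univ f]
    refine Finset.sum_congr rfl fun m _ => ?_
    rw [hcoeff, smul_eq_mul, mul_comm]
    congr 2
    ext j
    simp [Pi.single_apply, eq_comm]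
  refine ⟨f, Polynomial.ofFn (d + 1) c, ?_, by omega, heval, fun x hx => ?_, hfv⟩
  · intro hP
    refine hf (LinearMap.pi_ext' fun m => LinearMap.ext_ring ?_)
    simpa [hP] using (hcoeff m).symm
  · rw [← heval, ← hfv]
    exact hle _ (momentCurve_mem_momentSpace hx)

/-- Weights on at most `d + 1` nodes are determined by their moments up to order `d`. -/
theorem eqOn_of_sum_mul_pow_eq {Z : Finset ℝ} (hZ : Z.card ≤ d + 1) {F G : ℝ → ℝ}
    (h : ∀ m ≤ d, ∑ x ∈ Z, F x * x ^ m = ∑ x ∈ Z, G x * x ^ m) {y : ℝ} (hy : y ∈ Z) :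
    F y = G y := by
  have hpoly : ∀ q : Polynomial ℝ, q.natDegree < d + 1 →
      ∑ x ∈ Z, F x * q.eval x = ∑ x ∈ Z, G x * q.eval x := by
    intro q hq
    simp_rw [Polynomial.eval_eq_sum_range' hq, Finset.mul_sum]
    rw [Finset.sum_comm, Finset.sum_comm (s := Z)]
    refine Finset.sum_congr rfl fun m hm => ?_
    simp_rw [mul_left_comm _ (q.coeff m), ← Finset.mul_sum]
    rw [h m (by simpa [Nat.lt_succ_iff] using hm)]
  have hbasis := hpoly (Lagrange.basis Z id y) <| by
    have hd := Polynomial.natDegree_eq_of_degree_eq_some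
      (Lagrange.degree_basis (Function.injective_id.injOn (s := (Z : Set ℝ))) hy)
    have := Finset.card_pos.2 ⟨y, hy⟩
    omega
  have hsum : ∀ H : ℝ → ℝ, ∑ x ∈ Z, H x * (Lagrange.basis Z id y).eval x = H y := by
    intro H
    rw [Finset.sum_eq_single_of_mem y hy]
    · have := Lagrange.eval_basis_self (Function.injective_id.injOn (s := (Z : Set ℝ))) hy
      rw [id] at this
      rw [this, mul_one]
    · intro x hx hxy
      have := Lagrange.eval_basis_of_ne (v := id) (Ne.symm hxy) hx
      rw [id] at this
      rw [this, mul_zero]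
  rwa [hsum, hsum] at hbasis

/-- A moment vector annihilated by a nonzero polynomial of degree at most `d` that is nonnegative
on `[a, b]` is a boundary point of the moment space. -/
theorem mem_frontier_momentSpace (hab : a ≤ b) {s : Finset ℝ} {w : ℝ → ℝ}
    (hs : (s : Set ℝ) ⊆ Set.Icc a b) (hw : ∀ x ∈ s, 0 ≤ w x) {P : Polynomial ℝ} (hP : P ≠ 0)
    (hdeg : P.natDegree ≤ d) (hpos : ∀ x ∈ Set.Icc a b, 0 ≤ P.eval x)
    (hzero : ∀ x ∈ s, P.eval x = 0) :
    ∑ x ∈ s, w x • momentCurve d x ∈ frontier (momentSpace a b d) := by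
  set v := ∑ x ∈ s, w x • momentCurve d x with hv
  refine ⟨subset_closure (sum_smul_momentCurve_mem_momentSpace s w _ hw fun x hx => hs hx),
    fun hint => ?_⟩
  let c : Fin (d + 1) → ℝ := fun m => P.coeff m
  have heval : ∀ x, c ⬝ᵥ momentCurve d x = P.eval x := by
    intro x
    rw [Polynomial.eval_eq_sum_range' (Nat.lt_succ_of_le hdeg), Finset.sum_range]
    rfl
  have hnonneg : ∀ u ∈ momentSpace a b d, 0 ≤ c ⬝ᵥ u := by
    intro u hu
    obtain ⟨t, g, ht, hg, rfl⟩ := exists_finset_of_mem_momentSpace hab hu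
    rw [dotProduct_sum]
    refine Finset.sum_nonneg fun x hx => ?_
    rw [dotProduct_smul, heval]
    exact mul_nonneg (hg x hx).le (hpos x (ht hx))
  have hcv : c ⬝ᵥ v = 0 := by
    rw [hv, dotProduct_sum]
    refine Finset.sum_eq_zero fun x hx => ?_
    rw [dotProduct_smul, heval, hzero x hx, smul_zero]
  have hc : c ≠ 0 := by
    intro hc
    refine hP (Polynomial.leadingCoeff_eq_zero.1 ?_)
    exact congrFun hc ⟨P.natDegree, Nat.lt_succ_of_le hdeg⟩
  have hcc : 0 < c ⬝ᵥ c :=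
    (Finset.sum_nonneg fun i _ => mul_self_nonneg (c i)).lt_of_ne
      fun h => hc (dotProduct_self_eq_zero.1 h.symm)
  have hcont : Filter.Tendsto (fun t : ℝ => v - t • c) (nhds 0) (nhds v) := by
    have : Continuous fun t : ℝ => v - t • c := by fun_prop
    simpa using this.tendsto 0
  have hev := hcont.eventually (mem_interior_iff_mem_nhds.1 hint)
  obtain ⟨t, ht, htpos⟩ := ((hev.filter_mono nhdsWithin_le_nhds).and
    (self_mem_nhdsWithin : Set.Ioi (0 : ℝ) ∈ nhdsWithin 0 (Set.Ioi 0))).exists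
  have h := hnonneg _ ht
  rw [dotProduct_sub, dotProduct_smul, hcv, zero_sub, smul_eq_mul] at h
  have := mul_pos (Set.mem_Ioi.1 htpos) hcc
  linarith

/-- There is a polynomial nonnegative on `[a, b]` that vanishes on a given finite set and has degree
at most twice the index of that set. -/
theorem exists_polynomial_vanishing_on (hab : a ≠ b) (s : Finset ℝ) :
    ∃ P : Polynomial ℝ, P ≠ 0 ∧
      P.natDegree + (if a ∈ s then 1 else 0) + (if b ∈ s then 1 else 0) ≤ 2 * s.card ∧
      (∀ x ∈ Set.Icc a b, 0 ≤ P.eval x) ∧ ∀ x ∈ s, P.eval x = 0 := by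
  let q : ℝ → Polynomial ℝ := fun y =>
    if y = a then Polynomial.X - Polynomial.C a
    else if y = b then -(Polynomial.X - Polynomial.C b)
    else (Polynomial.X - Polynomial.C y) ^ 2
  have hq : ∀ y, q y ≠ 0 := by
    intro y
    simp only [q]
    split_ifs
    · exact Polynomial.X_sub_C_ne_zero a
    · exact neg_ne_zero.2 (Polynomial.X_sub_C_ne_zero b)
    · exact pow_ne_zero 2 (Polynomial.X_sub_C_ne_zero y)
  have hdeg : ∀ y, (q y).natDegree + (if y = a then 1 else 0) + (if y = b then 1 else 0) = 2 := by
    intro y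
    simp only [q]
    split_ifs with h₁ h₂ h₂
    · exact absurd (h₁.symm.trans h₂) hab
    · simp
    · rw [Polynomial.natDegree_neg, Polynomial.natDegree_X_sub_C]
    · simp
  refine ⟨∏ y ∈ s, q y, Finset.prod_ne_zero_iff.2 fun y _ => hq y, ?_, fun x hx => ?_,
    fun x hx => ?_⟩
  · rw [Polynomial.natDegree_prod _ _ fun y _ => hq y, ← Finset.sum_ite_eq' s a fun _ => 1,
      ← Finset.sum_ite_eq' s b fun _ => 1, ← Finset.sum_add_distrib, ← Finset.sum_add_distrib,
      Finset.sum_congr rfl fun y _ => hdeg y]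
    simp [mul_comm]
  · rw [Polynomial.eval_prod]
    refine Finset.prod_nonneg fun y _ => ?_
    simp only [q]
    split_ifs
    · simpa using hx.1
    · simpa using hx.2
    · simpa using sq_nonneg (x - y)
  · rw [Polynomial.eval_prod]
    refine Finset.prod_eq_zero hx ?_
    simp only [q]
    split_ifs with h₁ h₂ <;> simp [*]

end MomentSpace

/-- If `(M₀, …, M_d)` lies on the boundary of the moment space `𝓜_{d+1}` for the
system `(1, x, …, x^d)` on `[a,b]`, then it has a unique representation as a finitely
supported positive measure; conversely, a representation with index at most `d/2`
(endpoints `a`, `b` counted as one half) forces `(M₀, …, M_d)` to be a boundary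
point of `𝓜_{d+1}`. -/
theorem stmt18 (a b : ℝ) (hab : a < b) (d : ℕ) (M : ℕ → ℝ) :
    let MomS : Set (Fin (d + 1) → ℝ) := {v | ∃ σ : Measure ℝ, IsFiniteMeasure σ ∧
      σ (Set.Icc a b)ᶜ = 0 ∧ ∀ m : Fin (d + 1), (∫ x, x ^ (m : ℕ) ∂σ) = v m}
    let IsRep : Finset ℝ → (ℝ → ℝ) → Prop := fun s f =>
      (↑s : Set ℝ) ⊆ Set.Icc a b ∧ (∀ x ∈ s, 0 < f x) ∧
        ∀ m ≤ d, ∑ x ∈ s, f x * x ^ m = M m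
    ((fun m : Fin (d + 1) => M (m : ℕ)) ∈ frontier MomS →
      ∃ s f, IsRep s f ∧ ∀ s' f', IsRep s' f' → s' = s ∧ ∀ x ∈ s, f' x = f x) ∧
    ((∃ s f, IsRep s f ∧
        (s.card : ℝ) - (if a ∈ s then 1 / 2 else 0) - (if b ∈ s then 1 / 2 else 0)
          ≤ (d : ℝ) / 2) →
      (fun m : Fin (d + 1) => M (m : ℕ)) ∈ frontier MomS) := by
  intro MomS IsRep
  change (_ ∈ frontier (momentSpace a b d) → _) ∧ (_ → _ ∈ frontier (momentSpace a b d))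
  have hrep : ∀ (s : Finset ℝ) (f : ℝ → ℝ), (∀ m ≤ d, ∑ x ∈ s, f x * x ^ m = M m) ↔
      (fun m : Fin (d + 1) => M m) = ∑ x ∈ s, f x • momentCurve d x := by
    intro s f
    simp only [funext_iff, Finset.sum_apply, Pi.smul_apply, momentCurve, smul_eq_mul]
    exact ⟨fun h m => (h m (Nat.lt_succ_iff.1 m.2)).symm,
      fun h m hm => (h ⟨m, Nat.lt_succ_iff.2 hm⟩).symm⟩
  constructor
  · intro hM
    obtain ⟨L, P, hP, hdeg, hL, hneg, hLM⟩ := exists_polynomial_of_mem_frontier hab.le hM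
    obtain ⟨s, f, hs, hf, hsf⟩ := exists_finset_of_mem_momentSpace hab.le
      ((isClosed_momentSpace hab.le).frontier_subset hM)
    have hroots : ∀ s f, IsRep s f → s ⊆ P.roots.toFinset := by
      rintro s f ⟨hs, hf, hm⟩ x hx
      rw [(hrep s f).1 hm, map_sum] at hLM
      have h := (Finset.sum_eq_zero_iff_of_nonpos fun y hy => by
        rw [map_smul, hL]
        exact mul_nonpos_of_nonneg_of_nonpos (hf y hy).le (hneg y (hs hy))).1 hLM x hx
      rw [map_smul, hL, smul_eq_mul, mul_eq_zero_iff_left (hf x hx).ne'] at h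
      simpa [hP] using h
    have hcard : P.roots.toFinset.card ≤ d + 1 :=
      (P.roots.toFinset_card_le.trans (P.card_roots'.trans hdeg)).trans (Nat.le_succ d)
    have hextend : ∀ s f, IsRep s f → ∀ m ≤ d,
        ∑ x ∈ P.roots.toFinset, (if x ∈ s then f x else 0) * x ^ m = M m := by
      intro s f h m hm
      simp_rw [ite_mul, zero_mul]
      rw [Finset.sum_ite_mem, Finset.inter_eq_right.2 (hroots s f h)]
      exact h.2.2 m hm
    have hR : IsRep s f := ⟨hs, hf, (hrep s f).2 hsf⟩
    refine ⟨s, f, hR, fun s' f' hR' => ?_⟩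
    have heq : ∀ x ∈ P.roots.toFinset,
        (if x ∈ s' then f' x else 0) = if x ∈ s then f x else 0 := fun x hx =>
      eqOn_of_sum_mul_pow_eq (F := fun x => if x ∈ s' then f' x else 0)
        (G := fun x => if x ∈ s then f x else 0) hcard
        (fun m hm => (hextend s' f' hR' m hm).trans (hextend s f hR m hm).symm) hx
    have hss : s' = s := by
      ext x
      constructor <;> intro hx <;> by_contra hx'
      · have h := heq x (hroots s' f' hR' hx)
        rw [if_pos hx, if_neg hx'] at h
        exact (hR'.2.1 x hx).ne' h
      · have h := heq x (hroots s f hR hx)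
        rw [if_neg hx', if_pos hx] at h
        exact (hf x hx).ne h
    refine ⟨hss, fun x hx => ?_⟩
    simpa [hss, hx] using heq x (hroots s f hR hx)
  · rintro ⟨s, f, ⟨hs, hf, hm⟩, hindex⟩
    obtain ⟨P, hP, hdeg, hpos, hzero⟩ := exists_polynomial_vanishing_on hab.ne s
    rw [(hrep s f).1 hm]
    refine mem_frontier_momentSpace hab.le hs (fun x hx => (hf x hx).le) hP ?_ hpos hzero
    have hdeg' : (P.natDegree : ℝ) + (if a ∈ s then 1 else 0) + (if b ∈ s then 1 else 0) ≤
        2 * s.card := by exact_mod_cast hdeg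
    have : (P.natDegree : ℝ) ≤ d := by
      split_ifs at hindex hdeg' <;> linarith
    exact_mod_cast this
end
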